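/- arXiv:1007.2261 — 2 statements merged into one kernel-verified Lean document; each statement's English description precedes it below -/
import Mathlib

section
/- For every integer n ≥ 2 there exists an integer M > 0, depending only on n, such that for every family (Rᵢ)_{i ∈ I} of commutative local rings, every element of SL(n, ∏_{i ∈ I} Rᵢ) is a product of at most M elementary transvections eᵢⱼ(t) with t ∈ ∏_{i ∈ I} Rᵢ. -/
/-- The elementary transvection `e i j t = 1 + t·Eᵢⱼ` as an element of `SL(n, R)`. -/
def elemTransvection {n : ℕ} {R : Type*} [CommRing R] (i j : Fin n) (hij : i ≠ j) (t : R) :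
    Matrix.SpecialLinearGroup (Fin n) R :=
  ⟨Matrix.transvection i j t, Matrix.det_transvection_of_ne i j hij t⟩

/-- `g ∈ SL(n, R)` is a product of at most `N` elementary transvections. -/
def IsProductOfElemTransvections {n : ℕ} {R : Type*} [CommRing R]
    (g : Matrix.SpecialLinearGroup (Fin n) R) (N : ℕ) : Prop :=
  ∃ L : List (Matrix.SpecialLinearGroup (Fin n) R),
    L.length ≤ N ∧
    (∀ x ∈ L, ∃ (i j : Fin n) (hij : i ≠ j) (t : R), x = elemTransvection i j hij t) ∧
    L.prod = g

open Matrix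

section BorderedMatrices

variable {n : ℕ} {R : Type*}

/-- The block matrix with top left entry `a`, remaining first row `r`, remaining first column `c`
and lower right block `A`. -/
def borderedMatrix (a : R) (r c : Fin n → R) (A : Matrix (Fin n) (Fin n) R) :
    Matrix (Fin (n + 1)) (Fin (n + 1)) R :=
  Matrix.of (Fin.cons (Fin.cons a r) fun i => Fin.cons (c i) (A i))

@[simp]
theorem borderedMatrix_zero_zero (a : R) (r c : Fin n → R) (A : Matrix (Fin n) (Fin n) R) :
    borderedMatrix a r c A 0 0 = a := rfl

@[simp]
theorem borderedMatrix_zero_succ (a : R) (r c : Fin n → R) (A : Matrix (Fin n) (Fin n) R)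
    (j : Fin n) : borderedMatrix a r c A 0 j.succ = r j := rfl

@[simp]
theorem borderedMatrix_succ_zero (a : R) (r c : Fin n → R) (A : Matrix (Fin n) (Fin n) R)
    (i : Fin n) : borderedMatrix a r c A i.succ 0 = c i := rfl

@[simp]
theorem borderedMatrix_succ_succ (a : R) (r c : Fin n → R) (A : Matrix (Fin n) (Fin n) R)
    (i j : Fin n) : borderedMatrix a r c A i.succ j.succ = A i j := rfl

theorem exists_eq_borderedMatrix (M : Matrix (Fin (n + 1)) (Fin (n + 1)) R) :
    ∃ a r c A, M = borderedMatrix a r c A := by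
  refine ⟨M 0 0, fun j => M 0 j.succ, fun i => M i.succ 0, M.submatrix Fin.succ Fin.succ, ?_⟩
  ext i j
  cases i using Fin.cases <;> cases j using Fin.cases <;> simp

variable [CommRing R]

theorem borderedMatrix_mul (a a' : R) (r r' c c' : Fin n → R) (A A' : Matrix (Fin n) (Fin n) R) :
    borderedMatrix a r c A * borderedMatrix a' r' c' A' =
      borderedMatrix (a * a' + r ⬝ᵥ c') (a • r' + r ᵥ* A') (a' • c + A *ᵥ c')
        (vecMulVec c r' + A * A') := by
  ext i j
  cases i using Fin.cases <;> cases j using Fin.cases <;>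
    simp [Matrix.mul_apply, Fin.sum_univ_succ, dotProduct, vecMul, mulVec, vecMulVec_apply,
      mul_comm]

theorem borderedMatrix_one : borderedMatrix (1 : R) 0 0 (1 : Matrix (Fin n) (Fin n) R) = 1 := by
  ext i j
  cases i using Fin.cases <;> cases j using Fin.cases <;>
    simp [Matrix.one_apply, Fin.succ_ne_zero, (Fin.succ_ne_zero _).symm]

theorem det_borderedMatrix_of_col_eq_zero (a : R) (r : Fin n → R) (A : Matrix (Fin n) (Fin n) R) :
    (borderedMatrix a r 0 A).det = a * A.det := by
  rw [det_succ_column_zero, Fin.sum_univ_succ]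
  simp
  rfl

end BorderedMatrices

section Embeddings

variable {n : ℕ} {R : Type*} [CommRing R]

/-- The embedding of `SL(n, R)` into `SL(n + 1, R)` as the lower right block. -/
def lowerRightEmbedding :
    SpecialLinearGroup (Fin n) R →* SpecialLinearGroup (Fin (n + 1)) R where
  toFun g := ⟨borderedMatrix 1 0 0 g, by simp [det_borderedMatrix_of_col_eq_zero]⟩
  map_one' := Subtype.ext (by simp [borderedMatrix_one])
  map_mul' g h := Subtype.ext <| by
    change borderedMatrix 1 0 0 (g.1 * h.1) = borderedMatrix 1 0 0 g.1 * borderedMatrix 1 0 0 h.1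
    simp [borderedMatrix_mul]

theorem coe_lowerRightEmbedding (g : SpecialLinearGroup (Fin n) R) :
    (lowerRightEmbedding g : Matrix (Fin (n + 1)) (Fin (n + 1)) R) = borderedMatrix 1 0 0 g :=
  rfl

theorem lowerRightEmbedding_elemTransvection (i j : Fin n) (hij : i ≠ j) (t : R) :
    lowerRightEmbedding (elemTransvection i j hij t) =
      elemTransvection i.succ j.succ ((Fin.succ_injective n).ne hij) t := by
  apply Subtype.ext
  rw [coe_lowerRightEmbedding]
  ext k l
  cases k using Fin.cases <;> cases l using Fin.cases <;>
    simp [elemTransvection, transvection, Matrix.one_apply, Matrix.single_apply,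
      Fin.succ_ne_zero, (Fin.succ_ne_zero _).symm]

/-- The matrix in `SL(n + 1, R)` with first row `(1, r)` agreeing with the identity elsewhere. -/
def rowUnipotent (r : Fin n → R) : SpecialLinearGroup (Fin (n + 1)) R :=
  ⟨borderedMatrix 1 r 0 1, by simp [det_borderedMatrix_of_col_eq_zero]⟩

/-- The matrix in `SL(n + 1, R)` with first column `(1, c)` agreeing with the identity
elsewhere. -/
def colUnipotent (c : Fin n → R) : SpecialLinearGroup (Fin (n + 1)) R :=
  (rowUnipotent c).transpose

theorem coe_rowUnipotent (r : Fin n → R) :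
    (rowUnipotent r : Matrix (Fin (n + 1)) (Fin (n + 1)) R) = borderedMatrix 1 r 0 1 :=
  rfl

theorem coe_colUnipotent (c : Fin n → R) :
    (colUnipotent c : Matrix (Fin (n + 1)) (Fin (n + 1)) R) = borderedMatrix 1 0 c 1 := by
  rw [colUnipotent, SpecialLinearGroup.coe_transpose, coe_rowUnipotent]
  ext i j
  cases i using Fin.cases <;> cases j using Fin.cases <;> simp [Matrix.one_apply, eq_comm]

theorem rowUnipotent_zero : rowUnipotent (0 : Fin n → R) = 1 :=
  Subtype.ext borderedMatrix_one

theorem rowUnipotent_add (r s : Fin n → R) :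
    rowUnipotent (r + s) = rowUnipotent r * rowUnipotent s :=
  Subtype.ext (by simp [coe_rowUnipotent, borderedMatrix_mul, add_comm])

theorem rowUnipotent_inv (r : Fin n → R) : (rowUnipotent r)⁻¹ = rowUnipotent (-r) := by
  rw [inv_eq_iff_mul_eq_one, ← rowUnipotent_add, add_neg_cancel, rowUnipotent_zero]

theorem colUnipotent_inv (c : Fin n → R) : (colUnipotent c)⁻¹ = colUnipotent (-c) := by
  rw [inv_eq_iff_mul_eq_one]
  apply Subtype.ext
  simp [coe_colUnipotent, borderedMatrix_mul, borderedMatrix_one]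

theorem rowUnipotent_single (i : Fin n) (t : R) :
    rowUnipotent (Pi.single i t) = elemTransvection 0 i.succ (Fin.succ_ne_zero i).symm t := by
  apply Subtype.ext
  rw [coe_rowUnipotent]
  ext k l
  cases k using Fin.cases <;> cases l using Fin.cases <;>
    simp [elemTransvection, transvection, Matrix.one_apply, Matrix.single_apply,
      Fin.succ_ne_zero, (Fin.succ_ne_zero _).symm, Pi.single_apply, eq_comm]

end Embeddings

namespace IsProductOfElemTransvections

variable {n : ℕ} {R : Type*} [CommRing R]

theorem one : IsProductOfElemTransvections (1 : SpecialLinearGroup (Fin n) R) 0 :=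
  ⟨[], by simp⟩

theorem elemTransvection (i j : Fin n) (hij : i ≠ j) (t : R) :
    IsProductOfElemTransvections (elemTransvection i j hij t) 1 :=
  ⟨[_root_.elemTransvection i j hij t], by simp, by simpa using ⟨i, j, hij, t, rfl⟩, by simp⟩

theorem mono {g : SpecialLinearGroup (Fin n) R} {N N' : ℕ}
    (hg : IsProductOfElemTransvections g N) (h : N ≤ N') : IsProductOfElemTransvections g N' := by
  obtain ⟨L, hL, hg⟩ := hg
  exact ⟨L, hL.trans h, hg⟩

theorem mul {g h : SpecialLinearGroup (Fin n) R} {N N' : ℕ}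
    (hg : IsProductOfElemTransvections g N) (hh : IsProductOfElemTransvections h N') :
    IsProductOfElemTransvections (g * h) (N + N') := by
  obtain ⟨L, hL, hLt, rfl⟩ := hg
  obtain ⟨L', hL', hLt', rfl⟩ := hh
  refine ⟨L ++ L', by simp; omega, fun x hx => ?_, by simp⟩
  exact (List.mem_append.1 hx).elim (hLt x) (hLt' x)

theorem transpose {g : SpecialLinearGroup (Fin n) R} {N : ℕ}
    (hg : IsProductOfElemTransvections g N) : IsProductOfElemTransvections g.transpose N := by
  obtain ⟨L, hL, hLt, rfl⟩ := hg
  refine mono ?_ hL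
  clear hL
  induction L with
  | nil =>
    have h : (1 : SpecialLinearGroup (Fin n) R).transpose = 1 := Subtype.ext (by simp)
    simpa [h] using one
  | cons x L ih =>
    obtain ⟨i, j, hij, t, rfl⟩ := hLt x (by simp)
    have h : (_root_.elemTransvection i j hij t * L.prod).transpose =
        L.prod.transpose * _root_.elemTransvection j i hij.symm t := by
      apply Subtype.ext
      change (transvection i j t * L.prod.1)ᵀ = L.prod.1ᵀ * transvection j i t
      simp [transvection]
    rw [List.prod_cons, h, List.length_cons]
    exact (ih fun x hx => hLt x (by simp [hx])).mul (elemTransvection j i hij.symm t)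

theorem lowerRightEmbedding {g : SpecialLinearGroup (Fin n) R} {N : ℕ}
    (hg : IsProductOfElemTransvections g N) :
    IsProductOfElemTransvections (lowerRightEmbedding g) N := by
  obtain ⟨L, hL, hLt, rfl⟩ := hg
  refine ⟨L.map _root_.lowerRightEmbedding, by simpa using hL, fun x hx => ?_,
    (map_list_prod _ L).symm⟩
  obtain ⟨y, hy, rfl⟩ := List.mem_map.1 hx
  obtain ⟨i, j, hij, t, rfl⟩ := hLt y hy
  exact ⟨_, _, _, t, lowerRightEmbedding_elemTransvection i j hij t⟩

theorem rowUnipotent (r : Fin n → R) : IsProductOfElemTransvections (rowUnipotent r) n := by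
  have h (s : Finset (Fin n)) : IsProductOfElemTransvections
      (_root_.rowUnipotent (∑ i ∈ s, Pi.single i (r i))) s.card := by
    induction s using Finset.induction_on with
    | empty => simpa [rowUnipotent_zero] using one
    | insert i s hi ih =>
      rw [Finset.sum_insert hi, Finset.card_insert_of_notMem hi, rowUnipotent_add,
        rowUnipotent_single, Nat.add_comm s.card 1]
      exact (elemTransvection _ _ _ _).mul ih
  simpa [Finset.univ_sum_single] using h Finset.univ

theorem colUnipotent (c : Fin n → R) : IsProductOfElemTransvections (colUnipotent c) n :=
  (rowUnipotent c).transpose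

end IsProductOfElemTransvections

section StableRange

variable {R : Type*} [CommRing R]

/-- Over a ring of stable range one, left multiplication by a `rowUnipotent` turns the top left
entry of a matrix in `SL(n + 1, R)` into a unit. -/
theorem exists_isUnit_rowUnipotent_mul
    (hR : ∀ a b : R, IsCoprime a b → ∃ t, IsUnit (a + t * b)) {n : ℕ}
    (g : SpecialLinearGroup (Fin (n + 1)) R) :
    ∃ r : Fin n → R, IsUnit ((rowUnipotent r * g) 0 0) := by
  have hg : ∑ i, g⁻¹ 0 i * g i 0 = 1 := by
    change (g⁻¹ * g).1 0 0 = 1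
    rw [inv_mul_cancel]
    exact one_apply_eq 0
  rw [Fin.sum_univ_succ] at hg
  obtain ⟨t, ht⟩ := hR (g 0 0) (∑ i : Fin n, g⁻¹ 0 i.succ * g i.succ 0)
    ⟨g⁻¹ 0 0, 1, by rw [one_mul, hg]⟩
  refine ⟨fun i => t * g⁻¹ 0 i.succ, ?_⟩
  change IsUnit (∑ i, borderedMatrix 1 _ 0 1 0 i * g i 0)
  rw [Fin.sum_univ_succ]
  simpa [Finset.mul_sum, mul_assoc] using ht

/-- A matrix in `SL(n + 2, R)` whose top left entry is a unit becomes, after multiplication by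
three unipotent factors, a product of a matrix in `SL(n + 1, R)` and a `rowUnipotent`. -/
theorem exists_unipotent_mul_eq_lowerRightEmbedding_mul {n : ℕ}
    (g : SpecialLinearGroup (Fin (n + 2)) R) (hg : IsUnit (g 0 0)) :
    ∃ (c c' r r' : Fin (n + 1) → R) (h : SpecialLinearGroup (Fin (n + 1)) R),
      colUnipotent c * (rowUnipotent r * (colUnipotent c' * g)) =
        lowerRightEmbedding h * rowUnipotent r' := by
  obtain ⟨a, r, c, A, hM⟩ := exists_eq_borderedMatrix (g : Matrix (Fin (n + 2)) (Fin (n + 2)) R)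
  rw [hM, borderedMatrix_zero_zero] at hg
  obtain ⟨u, rfl⟩ := hg
  let e : Fin (n + 1) → R := Pi.single 0 1
  let c' : Fin (n + 1) → R := (↑u⁻¹ : R) • (e - c)
  let k := colUnipotent (-e) * (rowUnipotent ((1 - (u : R)) • e) * (colUnipotent c' * g))
  have hcol : (u : R) • c' + c = e := by simp [c', smul_smul]
  obtain ⟨r', A', hk⟩ : ∃ r' A', (k : Matrix (Fin (n + 2)) (Fin (n + 2)) R) = borderedMatrix 1 r' 0 A' := by
    change ∃ r' A', (colUnipotent (-e)).1 * ((rowUnipotent ((1 - (u : R)) • e)).1 *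
      ((colUnipotent c').1 * g.1)) = borderedMatrix 1 r' 0 A'
    simp only [coe_rowUnipotent, coe_colUnipotent, hM,
      borderedMatrix_mul, one_mulVec, zero_dotProduct, hcol, one_mul, add_zero]
    refine ⟨_, _, congrArg₂ (fun x y => borderedMatrix x _ y _) ?_ ?_⟩ <;> simp [e]
  have hA' : A'.det = 1 := by
    have := k.det_coe
    rwa [hk, det_borderedMatrix_of_col_eq_zero, one_mul] at this
  refine ⟨-e, c', (1 - (u : R)) • e, r', ⟨A', hA'⟩, Subtype.ext ?_⟩
  change k.1 = borderedMatrix 1 0 0 A' * borderedMatrix 1 r' 0 1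
  simp [hk, borderedMatrix_mul]

theorem isProductOfElemTransvections_of_stableRange
    (hR : ∀ a b : R, IsCoprime a b → ∃ t, IsUnit (a + t * b)) :
    ∀ {n : ℕ} (g : SpecialLinearGroup (Fin n) R), IsProductOfElemTransvections g (5 * n ^ 2)
  | 0, g | 1, g => by
    rw [Subsingleton.elim g 1]
    exact IsProductOfElemTransvections.one.mono (Nat.zero_le _)
  | n + 2, g => by
    obtain ⟨s, hs⟩ := exists_isUnit_rowUnipotent_mul hR g
    obtain ⟨c, c', r, r', h, hh⟩ := exists_unipotent_mul_eq_lowerRightEmbedding_mul _ hs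
    have hg : g = rowUnipotent (-s) * (colUnipotent (-c') * (rowUnipotent (-r) *
        (colUnipotent (-c) * (lowerRightEmbedding h * rowUnipotent r')))) := by
      rw [← hh, ← rowUnipotent_inv, ← rowUnipotent_inv, ← colUnipotent_inv, ← colUnipotent_inv]
      group
    rw [hg]
    have ih := isProductOfElemTransvections_of_stableRange hR h
    refine ((IsProductOfElemTransvections.rowUnipotent _).mul <|
      (IsProductOfElemTransvections.colUnipotent _).mul <|
      (IsProductOfElemTransvections.rowUnipotent _).mul <|
      (IsProductOfElemTransvections.colUnipotent _).mul <|
      ih.lowerRightEmbedding.mul (IsProductOfElemTransvections.rowUnipotent _)).mono ?_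
    ring_nf
    omega

theorem IsLocalRing.exists_isUnit_add_mul [IsLocalRing R] {a b : R} (h : IsCoprime a b) :
    ∃ t, IsUnit (a + t * b) := by
  by_cases ha : IsUnit a
  · exact ⟨0, by simpa using ha⟩
  · refine ⟨1, ?_⟩
    obtain ⟨x, y, hxy⟩ := h
    have hb : IsUnit b := by
      refine (isUnit_or_isUnit_of_add_one hxy).elim (fun hx => ?_) isUnit_of_mul_isUnit_right
      exact absurd (isUnit_of_mul_isUnit_right hx) ha
    by_contra hab
    have hna : -a ∈ nonunits R := fun hn => ha (by simpa using hn.neg)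
    exact nonunits_add hab hna (by simpa using hb)

theorem Pi.exists_isUnit_add_mul_of_isLocalRing {I : Type*} {R : I → Type*}
    [∀ i, CommRing (R i)] [∀ i, IsLocalRing (R i)] (a b : ∀ i, R i) (h : IsCoprime a b) :
    ∃ t, IsUnit (a + t * b) := by
  choose t ht using fun i => IsLocalRing.exists_isUnit_add_mul (h.map (Pi.evalRingHom R i))
  exact ⟨t, Pi.isUnit_iff.2 ht⟩

end StableRange

/-- For every `n ≥ 2` there exists `M > 0`, depending only on `n`, such
that for every family `(R i)` of commutative local rings, every element of
`SL(n, ∏ i, R i)` is a product of at most `M` elementary transvections. -/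
theorem exists_bound_pi_localRing_isProductOfElemTransvections (n : ℕ) (hn : 2 ≤ n) :
    ∃ M : ℕ, 0 < M ∧
      ∀ (I : Type*) (R : I → Type*) [∀ i, CommRing (R i)] [∀ i, IsLocalRing (R i)],
        ∀ g : Matrix.SpecialLinearGroup (Fin n) (∀ i, R i),
          IsProductOfElemTransvections g M :=
  ⟨5 * n ^ 2, by positivity, fun _ _ _ _ g =>
    isProductOfElemTransvections_of_stableRange Pi.exists_isUnit_add_mul_of_isLocalRing g⟩
end

section
/- Let R be a commutative ring, n ≥ 3, and let Eₙ(R) ⊆ SL(n, R) be the elementary subgroup, i.e. the subgroup generated by all elementary transvections eᵢⱼ(t), i ≠ j, t ∈ R. If N is a normal subgroup of Eₙ(R) of finite index, then there exists an ideal 𝔞 ⊆ R of finite index (the quotient ring R/𝔞 is finite) such that eᵢⱼ(a) ∈ N for all a ∈ 𝔞 and all pairs of indices i ≠ j. -/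
section ElemTransvection

variable {R : Type*} [CommRing R] {n : ℕ}

lemma elemTransvection_add {i j : Fin n} (hij : i ≠ j) (s t : R) :
    elemTransvection i j hij (s + t) =
      elemTransvection i j hij s * elemTransvection i j hij t :=
  Subtype.ext (Matrix.transvection_mul_transvection_same i j hij s t).symm

lemma elemTransvection_zero {i j : Fin n} (hij : i ≠ j) :
    elemTransvection i j hij (0 : R) = 1 :=
  Subtype.ext (Matrix.transvection_zero i j)

/-- The root subgroup homomorphism `t ↦ eᵢⱼ(t)`. -/
def elemTransvectionHom (i j : Fin n) (hij : i ≠ j) :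
    Multiplicative R →* Matrix.SpecialLinearGroup (Fin n) R where
  toFun t := elemTransvection i j hij t.toAdd
  map_one' := elemTransvection_zero hij
  map_mul' s t := elemTransvection_add hij s.toAdd t.toAdd

lemma elemTransvection_inv {i j : Fin n} (hij : i ≠ j) (t : R) :
    (elemTransvection i j hij t)⁻¹ = elemTransvection i j hij (-t) := by
  rw [inv_eq_iff_mul_eq_one, ← elemTransvection_add, add_neg_cancel, elemTransvection_zero]

/-- The Steinberg commutator relation. -/
lemma elemTransvection_mul {i j k : Fin n} (hij : i ≠ j) (hik : i ≠ k) (hkj : k ≠ j) (s t : R) :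
    elemTransvection i j hij (s * t) =
      elemTransvection i k hik s * elemTransvection k j hkj t *
        (elemTransvection i k hik s)⁻¹ * (elemTransvection k j hkj t)⁻¹ := by
  rw [elemTransvection_inv, elemTransvection_inv]
  apply Subtype.ext
  change Matrix.transvection i j (s * t) = Matrix.transvection i k s * Matrix.transvection k j t *
    Matrix.transvection i k (-s) * Matrix.transvection k j (-t)
  simp only [Matrix.transvection, mul_add, add_mul, mul_one, one_mul, ← Matrix.single_neg,
    mul_neg, neg_mul, Matrix.single_mul_single_same, add_zero,
    Matrix.single_mul_single_of_ne, ne_eq, hij.symm, hik.symm, hkj.symm, not_false_eq_true]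
  abel

/-- The ideal of all `a` such that `eᵢⱼ(a) ∈ N` for all `i ≠ j`, where `N` is a subgroup
normalized by the elementary transvections. -/
def levelIdeal (hn : 3 ≤ n) (N : Subgroup (Matrix.SpecialLinearGroup (Fin n) R))
    (hN : ∀ (i j : Fin n) (hij : i ≠ j) (t : R), ∀ x ∈ N,
      elemTransvection i j hij t * x * (elemTransvection i j hij t)⁻¹ ∈ N) : Ideal R where
  carrier := {a | ∀ (i j : Fin n) (hij : i ≠ j), elemTransvection i j hij a ∈ N}
  add_mem' ha hb i j hij := by
    rw [elemTransvection_add]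
    exact N.mul_mem (ha i j hij) (hb i j hij)
  zero_mem' i j hij := by
    rw [elemTransvection_zero]
    exact N.one_mem
  smul_mem' r a ha i j hij := by
    obtain ⟨k, hki, hkj⟩ := Fin.exists_ne_and_ne_of_two_lt i j hn
    rw [smul_eq_mul, elemTransvection_mul hij hki.symm hkj]
    exact N.mul_mem (hN i k hki.symm r _ (ha k j hkj)) (N.inv_mem (ha k j hkj))

lemma levelIdeal_toAddSubgroup (hn : 3 ≤ n)
    (N : Subgroup (Matrix.SpecialLinearGroup (Fin n) R))
    (hN : ∀ (i j : Fin n) (hij : i ≠ j) (t : R), ∀ x ∈ N,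
      elemTransvection i j hij t * x * (elemTransvection i j hij t)⁻¹ ∈ N) :
    (levelIdeal hn N hN).toAddSubgroup =
      ⨅ p : {p : Fin n × Fin n // p.1 ≠ p.2},
        Subgroup.toAddSubgroup' (N.comap (elemTransvectionHom p.1.1 p.1.2 p.2)) := by
  ext a
  simp only [AddSubgroup.mem_iInf, Subtype.forall, Prod.forall]
  rfl

end ElemTransvection

/-- Let `R` be a commutative ring, `n ≥ 3`, and `Eₙ(R) ⊆ SL(n, R)` the
elementary subgroup. If `N` is a normal subgroup of `Eₙ(R)` of finite index, then there is
an ideal `𝔞 ⊆ R` of finite index with `e i j a ∈ N` for all `a ∈ 𝔞` and all `i ≠ j`. -/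
theorem exists_finite_index_ideal_of_normal_finite_index
    {R : Type*} [CommRing R] {n : ℕ} (hn : 3 ≤ n)
    (E : Subgroup (Matrix.SpecialLinearGroup (Fin n) R))
    (hE : E = Subgroup.closure
      {x | ∃ (i j : Fin n) (hij : i ≠ j) (t : R), x = elemTransvection i j hij t})
    (N : Subgroup (Matrix.SpecialLinearGroup (Fin n) R)) (hNE : N ≤ E)
    (hnorm : (N.subgroupOf E).Normal) (hfin : (N.subgroupOf E).FiniteIndex) :
    ∃ 𝔞 : Ideal R, Finite (R ⧸ 𝔞) ∧
      ∀ a ∈ 𝔞, ∀ (i j : Fin n) (hij : i ≠ j), elemTransvection i j hij a ∈ N := by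
  have hmem (i j : Fin n) (hij : i ≠ j) (t : R) : elemTransvection i j hij t ∈ E :=
    hE ▸ Subgroup.subset_closure ⟨i, j, hij, t, rfl⟩
  have hN (i j : Fin n) (hij : i ≠ j) (t : R) (x) (hx : x ∈ N) :
      elemTransvection i j hij t * x * (elemTransvection i j hij t)⁻¹ ∈ N :=
    hnorm.conj_mem ⟨x, hNE hx⟩ hx ⟨_, hmem i j hij t⟩
  refine ⟨levelIdeal hn N hN, ?_, fun a ha => ha⟩
  have hcomap (p : {p : Fin n × Fin n // p.1 ≠ p.2}) :
      (Subgroup.toAddSubgroup'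
        (N.comap (elemTransvectionHom (R := R) p.1.1 p.1.2 p.2))).FiniteIndex := by
    have hrange : (elemTransvectionHom (R := R) p.1.1 p.1.2 p.2).range ≤ E := by
      rintro _ ⟨t, rfl⟩
      exact hmem _ _ p.2 t.toAdd
    have hindex : (N.comap (elemTransvectionHom (R := R) p.1.1 p.1.2 p.2)).index ≠ 0 := by
      rw [Subgroup.index_comap]
      exact fun h => hfin.index_ne_zero (Subgroup.relIndex_eq_zero_of_le_right hrange h)
    exact ⟨hindex⟩
  have hfinite : (levelIdeal hn N hN).toAddSubgroup.FiniteIndex := by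
    rw [levelIdeal_toAddSubgroup]
    exact AddSubgroup.finiteIndex_iInf hcomap
  exact (levelIdeal hn N hN).toAddSubgroup.finite_quotient_of_finiteIndex
end
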